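/- In a thin cut system, every optimally nested cut is nested with every other optimally nested cut, and the optimally nested cuts form a cut system. -/

import Mathlib

variable {V : Type*}

/-- The boundary `NC` of a vertex set: vertices outside `C` adjacent to `C`. -/
def bdry (G : SimpleGraph V) (C : Set V) : Set V :=
  {v | v ∉ C ∧ ∃ u ∈ C, G.Adj u v}

/-- The `*`-complement: `C* = VX \ (C ∪ NC)`. -/
def cstar (G : SimpleGraph V) (C : Set V) : Set V :=
  (C ∪ bdry G C)ᶜ

/-- A set of vertices is connected if its induced subgraph is connected. -/
def ConnSet (G : SimpleGraph V) (C : Set V) : Prop :=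
  (G.induce C).Connected

/-- `Q` is a component of `A`: a maximal connected subset of `A`. -/
def IsCompOf (G : SimpleGraph V) (Q A : Set V) : Prop :=
  Q ⊆ A ∧ ConnSet G Q ∧ ∀ R : Set V, Q ⊆ R → R ⊆ A → ConnSet G R → R = Q

/-- `A`, `B` form a pair of opposite corners of `C` and `D`. -/
def OppCorners (G : SimpleGraph V) (C D A B : Set V) : Prop :=
  (A = C ∩ D ∧ B = cstar G C ∩ cstar G D) ∨
  (A = cstar G C ∩ cstar G D ∧ B = C ∩ D) ∨
  (A = C ∩ cstar G D ∧ B = cstar G C ∩ D) ∨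
  (A = cstar G C ∩ D ∧ B = C ∩ cstar G D)

/-- Cut system (Definition 2.1). -/
structure IsCutSystem (G : SimpleGraph V) (𝒞 : Set (Set V)) : Prop where
  nonempty : ∀ C ∈ 𝒞, C.Nonempty
  conn : ∀ C ∈ 𝒞, ConnSet G C
  finBd : ∀ C ∈ 𝒞, (bdry G C).Finite
  star_star : ∀ C ∈ 𝒞, cstar G (cstar G C) = C
  a1 : ∀ C ∈ 𝒞, ∀ D ∈ 𝒞, ∀ A B : Set V, OppCorners G C D A B →
    (∃ E ∈ 𝒞, E ⊆ A) → (∃ E ∈ 𝒞, E ⊆ B) →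
    ∀ Q : Set V, (IsCompOf G Q A ∨ IsCompOf G Q B) → (∃ E ∈ 𝒞, E ⊆ Q) → Q ∈ 𝒞
  a2 : ∀ C ∈ 𝒞, ∀ D ∈ 𝒞, ∃ A B : Set V, OppCorners G C D A B ∧
    (∃ E ∈ 𝒞, E ⊆ A) ∧ (∃ E ∈ 𝒞, E ⊆ B)

/-- A thin cut system: all cuts have boundary of the minimal cardinality `κ`. -/
structure IsThinCutSystem (G : SimpleGraph V) (𝒞 : Set (Set V)) (κ : ℕ) : Prop where
  toIsCutSystem : IsCutSystem G 𝒞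
  thin : ∀ C ∈ 𝒞, (bdry G C).ncard = κ

/-- A pre-cut: a cut or the `*`-complement of a cut. -/
def PreCut (G : SimpleGraph V) (𝒞 : Set (Set V)) (E : Set V) : Prop :=
  E ∈ 𝒞 ∨ ∃ C ∈ 𝒞, E = cstar G C

/-- `A` is an isolated corner of the pair `C`, `D`: a corner containing no cut,
whose two adjacent links are empty. -/
def IsolatedCorner (G : SimpleGraph V) (𝒞 : Set (Set V)) (C D A : Set V) : Prop :=
  (¬ ∃ E ∈ 𝒞, E ⊆ A) ∧
  ((A = C ∩ D ∧ C ∩ bdry G D = ∅ ∧ D ∩ bdry G C = ∅) ∨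
   (A = C ∩ cstar G D ∧ C ∩ bdry G D = ∅ ∧ cstar G D ∩ bdry G C = ∅) ∨
   (A = cstar G C ∩ D ∧ cstar G C ∩ bdry G D = ∅ ∧ D ∩ bdry G C = ∅) ∨
   (A = cstar G C ∩ cstar G D ∧ cstar G C ∩ bdry G D = ∅ ∧ cstar G D ∩ bdry G C = ∅))

/-- Two sets are nested if they have an isolated corner. -/
def Nested (G : SimpleGraph V) (𝒞 : Set (Set V)) (C D : Set V) : Prop :=
  ∃ A : Set V, IsolatedCorner G 𝒞 C D A

/-- A slice: a component of the complement of a separator which is not a cut. -/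
def IsSlice (G : SimpleGraph V) (𝒞 : Set (Set V)) (Q : Set V) : Prop :=
  (∃ C ∈ 𝒞, IsCompOf G Q (bdry G C)ᶜ) ∧ Q ∉ 𝒞

/-- `Y` is `k`-inseparable (Definition 2.12). -/
def Insep (G : SimpleGraph V) (k : ℕ) (Y : Set V) : Prop :=
  (Y.Infinite ∨ k + 1 ≤ Y.ncard) ∧
  ∀ C : Set V, (bdry G C).Finite → (bdry G C).ncard ≤ k →
    Y ⊆ C ∪ bdry G C ∨ Y ⊆ cstar G C ∪ bdry G C

/-- `C` separates `Y₁` from `Y₂` (Definition 2.10, one orientation). -/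
def Separates (G : SimpleGraph V) (C Y₁ Y₂ : Set V) : Prop :=
  Y₁ ⊆ C ∪ bdry G C ∧ Y₂ ⊆ cstar G C ∪ bdry G C ∧
  ¬ Y₁ ⊆ bdry G C ∧ ¬ Y₂ ⊆ bdry G C

/-- The set `S` separates the vertices `x` and `y`. -/
def SepVert (G : SimpleGraph V) (S : Set V) (x y : V) : Prop :=
  x ∉ S ∧ y ∉ S ∧ ∀ K : Set V, IsCompOf G K Sᶜ → x ∈ K → y ∉ K

/-- `S` is a tight `x`-`y`-separator. -/
def TightSep (G : SimpleGraph V) (x y : V) (S : Set V) : Prop :=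
  ∃ A B : Set V, IsCompOf G A Sᶜ ∧ IsCompOf G B Sᶜ ∧ A ≠ B ∧ x ∈ A ∧ y ∈ B ∧
    ∀ s ∈ S, (∃ a ∈ A, G.Adj s a) ∧ (∃ b ∈ B, G.Adj s b)

/-- `μ(C)`: the number of cuts of the system not nested with `C`. -/
noncomputable def mu (G : SimpleGraph V) (𝒞 : Set (Set V)) (C : Set V) : ℕ :=
  {D ∈ 𝒞 | ¬ Nested G 𝒞 C D}.ncard


section ThinCuts

variable {G : SimpleGraph V} {𝒞 : Set (Set V)} {κ : ℕ} {A B C D E F Q R X Y : Set V} {x y : V}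

theorem mem_cstar {v : V} : v ∈ cstar G C ↔ v ∉ C ∧ v ∉ bdry G C := by
  simp [cstar]

theorem mem_union_bdry_of_adj {u v : V} (hu : u ∈ C) (h : G.Adj u v) : v ∈ C ∪ bdry G C := by
  by_cases hv : v ∈ C
  · exact Or.inl hv
  · exact Or.inr ⟨hv, u, hu, h⟩

theorem bdry_subset_of_subset (h : R ⊆ C) : bdry G R ⊆ C ∪ bdry G C := by
  rintro v ⟨-, u, hu, huv⟩
  exact mem_union_bdry_of_adj (h hu) huv

theorem bdry_cstar_subset : bdry G (cstar G C) ⊆ bdry G C := by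
  rintro v ⟨hv, u, hu, huv⟩
  rw [mem_cstar] at hv hu
  by_cases h : v ∈ C
  · exact absurd ⟨hu.1, v, h, huv.symm⟩ hu.2
  · by_contra h'
    exact hv ⟨h, h'⟩

theorem bdry_cstar (h : cstar G (cstar G C) = C) : bdry G (cstar G C) = bdry G C := by
  refine bdry_cstar_subset.antisymm ?_
  have := bdry_cstar_subset (G := G) (C := cstar G C)
  rwa [h] at this

namespace ConnSet

theorem nonempty (h : ConnSet G A) : A.Nonempty :=
  Set.nonempty_coe_sort.mp (SimpleGraph.Connected.nonempty h)

theorem subset_of_mem (h : ConnSet G A) {a : V} (ha : a ∈ A) (haC : a ∈ C)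
    (hd : ∀ v ∈ A, v ∉ bdry G C) : A ⊆ C := by
  intro b hb
  obtain ⟨p⟩ := h.preconnected ⟨a, ha⟩ ⟨b, hb⟩
  have key : ∀ {u v : A} (_ : (G.induce A).Walk u v), (u : V) ∈ C → (v : V) ∈ C := by
    intro u v p
    induction p with
    | nil => exact id
    | @cons u w v huw p ih =>
      intro hu
      exact ih ((mem_union_bdry_of_adj hu huw).resolve_right (hd _ w.2))
  exact key p haC

theorem subset_or_subset_cstar (h : ConnSet G A) (hd : ∀ v ∈ A, v ∉ bdry G C) :
    A ⊆ C ∨ A ⊆ cstar G C := by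
  by_cases hA : ∃ a ∈ A, a ∈ C
  · obtain ⟨a, ha, haC⟩ := hA
    exact Or.inl (h.subset_of_mem ha haC hd)
  · push Not at hA
    exact Or.inr fun v hv => mem_cstar.2 ⟨hA v hv, hd v hv⟩

theorem union_of_adj (hA : ConnSet G A) (hB : ConnSet G B) {u v : V} (hu : u ∈ A) (hv : v ∈ B)
    (h : G.Adj u v) : ConnSet G (A ∪ B) :=
  SimpleGraph.connected_induce_union hA.preconnected hB.preconnected hu hv h

theorem exists_finite (h : ConnSet G A) (hx : x ∈ A) (hy : y ∈ A) :
    ∃ F ⊆ A, F.Finite ∧ ConnSet G F ∧ x ∈ F ∧ y ∈ F := by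
  obtain ⟨p⟩ := h.preconnected ⟨x, hx⟩ ⟨y, hy⟩
  let q := p.map (SimpleGraph.Embedding.induce A).toHom
  refine ⟨{v | v ∈ q.support}, ?_, List.finite_toSet _, q.connected_induce_support,
    q.start_mem_support, q.end_mem_support⟩
  intro v hv
  simp only [q, SimpleGraph.Walk.support_map, Set.mem_ofPred_eq, List.mem_map] at hv
  obtain ⟨w, -, rfl⟩ := hv
  exact w.2

theorem exists_isCompOf (h : ConnSet G F) (hF : F ⊆ A) : ∃ Q, IsCompOf G Q A ∧ F ⊆ Q := by
  let S : Set (Set V) := {R | F ⊆ R ∧ R ⊆ A ∧ ConnSet G R}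
  have hFS : F ∈ S := ⟨subset_rfl, hF, h⟩
  obtain ⟨f, hf⟩ := h.nonempty
  refine ⟨⋃₀ S, ⟨Set.sUnion_subset fun R hR => hR.2.1, ?_, ?_⟩, Set.subset_sUnion_of_mem hFS⟩
  · exact SimpleGraph.induce_sUnion_connected_of_pairwise_not_disjoint ⟨F, hFS⟩
      (fun hs ht => ⟨f, hs.1 hf, ht.1 hf⟩) (fun hs => hs.2.2)
  · intro R hR hRA hRc
    exact (Set.subset_sUnion_of_mem
      (show R ∈ S from ⟨(Set.subset_sUnion_of_mem hFS).trans hR, hRA, hRc⟩)).antisymm hR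

end ConnSet

theorem connSet_singleton (v : V) : ConnSet G {v} := by
  have : Subsingleton ({v} : Set V) := inferInstance
  exact SimpleGraph.Connected.mk fun a b => by rw [Subsingleton.elim a b]

theorem IsCompOf.notMem_of_mem_bdry (h : IsCompOf G Q A) {v : V} (hv : v ∈ bdry G Q) : v ∉ A := by
  intro hvA
  obtain ⟨hvQ, u, hu, huv⟩ := hv
  have := h.2.2 (Q ∪ {v}) Set.subset_union_left
    (Set.union_subset h.1 (Set.singleton_subset_iff.2 hvA))
    (h.2.1.union_of_adj (connSet_singleton v) hu rfl huv)
  exact hvQ (this ▸ Or.inr rfl)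

theorem IsCompOf.bdry_subset (h : IsCompOf G Q A) : bdry G Q ⊆ bdry G A := by
  intro v hv
  exact (bdry_subset_of_subset h.1 hv).resolve_left (h.notMem_of_mem_bdry hv)

/-- The sets of `k` vertices avoiding `W` that separate `x` from `y` in `G - W` tightly. -/
def tightSeps (G : SimpleGraph V) (x y : V) (W : Set V) (k : ℕ) : Set (Set V) :=
  {S | S.Finite ∧ S.ncard = k ∧ Disjoint S W ∧ ∃ A B : Set V, ConnSet G A ∧ ConnSet G B ∧
    x ∈ A ∧ y ∈ B ∧ y ∉ A ∧ Disjoint A W ∧ Disjoint B W ∧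
    S ⊆ bdry G A ∧ bdry G A ⊆ S ∪ W ∧ S ⊆ bdry G B}

theorem finite_tightSeps (G : SimpleGraph V) (x y : V) (k : ℕ) (W : Set V) :
    (tightSeps G x y W k).Finite := by
  induction k generalizing W with
  | zero =>
    refine (Set.finite_singleton ∅).subset ?_
    rintro S ⟨hS, hk, -⟩
    exact (Set.ncard_eq_zero hS).1 hk
  | succ k ih =>
    obtain he | ⟨S₀, hS₀, hk₀, hSW₀, A₀, B₀, hA₀, hB₀, hx₀, hy₀, -, hAW₀, hBW₀, hSA₀, -, hSB₀⟩ :=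
      (tightSeps G x y W (k + 1)).eq_empty_or_nonempty
    · rw [he]; exact Set.finite_empty
    obtain ⟨s, hs⟩ : S₀.Nonempty := by
      rw [← Set.ncard_pos hS₀]; omega
    obtain ⟨-, a, ha, has⟩ := hSA₀ hs
    obtain ⟨-, b, hb, hbs⟩ := hSB₀ hs
    have hK : ConnSet G ((A₀ ∪ {s}) ∪ B₀) :=
      (hA₀.union_of_adj (connSet_singleton s) ha rfl has).union_of_adj hB₀ (Or.inr rfl) hb hbs.symm
    obtain ⟨P, hPK, hPf, hP, hxP, hyP⟩ :=
      hK.exists_finite (Or.inl (Or.inl hx₀)) (Or.inr hy₀)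
    have hPW : Disjoint P W := by
      refine Disjoint.mono_left hPK ?_
      rw [Set.disjoint_union_left, Set.disjoint_union_left, Set.disjoint_singleton_left]
      exact ⟨⟨hAW₀, Set.disjoint_left.1 hSW₀ hs⟩, hBW₀⟩
    refine (hPf.biUnion fun v _ => (ih (insert v W)).image (insert v)).subset ?_
    rintro S ⟨hS, hk, hSW, A, B, hA, hB, hx, hy, hyA, hAW, hBW, hSA, hAS, hSB⟩
    obtain ⟨v, hvP, hvA⟩ : ∃ v ∈ P, v ∈ bdry G A := by
      by_contra! hcon
      exact hyA (hP.subset_of_mem hxP hx hcon hyP)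
    have hvS : v ∈ S := (hAS hvA).resolve_right (Set.disjoint_left.1 hPW hvP)
    simp only [Set.mem_iUnion]
    refine ⟨v, hvP, S \ {v}, ⟨hS.sdiff, ?_, ?_, A, B, hA, hB, hx, hy, hyA, ?_, ?_, ?_, ?_, ?_⟩, ?_⟩
    · rw [Set.ncard_sdiff_singleton_of_mem hvS]; omega
    · rw [Set.disjoint_insert_right]
      exact ⟨fun h => h.2 rfl, hSW.mono_left Set.sdiff_subset⟩
    · rw [Set.disjoint_insert_right]
      exact ⟨hvA.1, hAW⟩
    · rw [Set.disjoint_insert_right]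
      exact ⟨(hSB hvS).1, hBW⟩
    · exact Set.sdiff_subset.trans hSA
    · intro w hw
      by_cases hwv : w = v
      · exact Or.inr (Or.inl hwv)
      · exact (hAS hw).imp (fun h => ⟨h, hwv⟩) Or.inr
    · exact Set.sdiff_subset.trans hSB
    · exact Set.insert_sdiff_self_of_mem hvS

theorem nested_iff : Nested G 𝒞 C D ↔
    ((¬ ∃ E ∈ 𝒞, E ⊆ C ∩ D) ∧ C ∩ bdry G D = ∅ ∧ D ∩ bdry G C = ∅) ∨
    ((¬ ∃ E ∈ 𝒞, E ⊆ C ∩ cstar G D) ∧ C ∩ bdry G D = ∅ ∧ cstar G D ∩ bdry G C = ∅) ∨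
    ((¬ ∃ E ∈ 𝒞, E ⊆ cstar G C ∩ D) ∧ cstar G C ∩ bdry G D = ∅ ∧ D ∩ bdry G C = ∅) ∨
    ((¬ ∃ E ∈ 𝒞, E ⊆ cstar G C ∩ cstar G D) ∧
      cstar G C ∩ bdry G D = ∅ ∧ cstar G D ∩ bdry G C = ∅) := by
  constructor
  · rintro ⟨A, hA, ⟨rfl, h⟩ | ⟨rfl, h⟩ | ⟨rfl, h⟩ | ⟨rfl, h⟩⟩
    · exact Or.inl ⟨hA, h⟩
    · exact Or.inr (Or.inl ⟨hA, h⟩)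
    · exact Or.inr (Or.inr (Or.inl ⟨hA, h⟩))
    · exact Or.inr (Or.inr (Or.inr ⟨hA, h⟩))
  · rintro (h | h | h | h)
    · exact ⟨_, h.1, Or.inl ⟨rfl, h.2⟩⟩
    · exact ⟨_, h.1, Or.inr (Or.inl ⟨rfl, h.2⟩)⟩
    · exact ⟨_, h.1, Or.inr (Or.inr (Or.inl ⟨rfl, h.2⟩))⟩
    · exact ⟨_, h.1, Or.inr (Or.inr (Or.inr ⟨rfl, h.2⟩))⟩

theorem nested_comm : Nested G 𝒞 C D ↔ Nested G 𝒞 D C := by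
  rw [nested_iff, nested_iff, Set.inter_comm C D, Set.inter_comm C (cstar G D),
    Set.inter_comm (cstar G C) D, Set.inter_comm (cstar G C) (cstar G D)]
  tauto

theorem nested_cstar_left (h : cstar G (cstar G C) = C) :
    Nested G 𝒞 (cstar G C) D ↔ Nested G 𝒞 C D := by
  rw [nested_iff, nested_iff, h, bdry_cstar h]
  tauto

theorem nested_cstar_right (h : cstar G (cstar G D) = D) :
    Nested G 𝒞 C (cstar G D) ↔ Nested G 𝒞 C D := by
  rw [nested_comm, nested_cstar_left h, nested_comm]

namespace IsThinCutSystem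

theorem not_subset_empty (h : IsThinCutSystem G 𝒞 κ) : ¬ ∃ E ∈ 𝒞, E ⊆ ∅ := by
  rintro ⟨E, hE, hE0⟩
  exact (h.toIsCutSystem.nonempty E hE).ne_empty (Set.subset_empty_iff.1 hE0)

theorem nested_of_disjoint_bdry (h : IsThinCutSystem G 𝒞 κ) (hQ : ConnSet G Q)
    (hd : ∀ v ∈ Q, v ∉ bdry G E) : Nested G 𝒞 Q E := by
  have hd' : Q ∩ bdry G E = ∅ := Set.disjoint_iff_inter_eq_empty.1 (Set.disjoint_left.2 hd)
  rw [nested_iff]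
  obtain hs | hs := hQ.subset_or_subset_cstar hd
  · have key : ∀ v ∈ cstar G E, v ∉ Q ∪ bdry G Q := by
      rintro v hv (hvQ | hvQ)
      · exact (mem_cstar.1 hv).1 (hs hvQ)
      · exact hv (bdry_subset_of_subset hs hvQ)
    refine Or.inr (Or.inl ⟨?_, hd', ?_⟩)
    · rw [Set.disjoint_iff_inter_eq_empty.1
        (Set.disjoint_left.2 fun v hv hv' => key v hv' (Or.inl hv))]
      exact h.not_subset_empty
    · exact Set.disjoint_iff_inter_eq_empty.1
        (Set.disjoint_left.2 fun v hv hv' => key v hv (Or.inr hv'))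
  · have key : ∀ v ∈ E, v ∉ Q ∪ bdry G Q := by
      rintro v hv (hvQ | hvQ)
      · exact (mem_cstar.1 (hs hvQ)).1 hv
      · obtain hv' | hv' := bdry_subset_of_subset hs hvQ
        · exact (mem_cstar.1 hv').1 hv
        · exact (bdry_cstar_subset hv').1 hv
    refine Or.inl ⟨?_, hd', ?_⟩
    · rw [Set.disjoint_iff_inter_eq_empty.1
        (Set.disjoint_left.2 fun v hv hv' => key v hv' (Or.inl hv))]
      exact h.not_subset_empty
    · exact Set.disjoint_iff_inter_eq_empty.1
        (Set.disjoint_left.2 fun v hv hv' => key v hv (Or.inr hv'))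

theorem ncard_bdry_preCut (h : IsThinCutSystem G 𝒞 κ) (hX : PreCut G 𝒞 X) :
    (bdry G X).Finite ∧ (bdry G X).ncard = κ := by
  obtain hX | ⟨C, hC, rfl⟩ := hX
  · exact ⟨h.toIsCutSystem.finBd X hX, h.thin X hX⟩
  · rw [bdry_cstar (h.toIsCutSystem.star_star C hC)]
    exact ⟨h.toIsCutSystem.finBd C hC, h.thin C hC⟩

theorem bdry_eq_of_subset (h : IsThinCutSystem G 𝒞 κ) (hX : PreCut G 𝒞 X) (hY : PreCut G 𝒞 Y)
    (hs : bdry G X ⊆ bdry G Y) : bdry G X = bdry G Y :=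
  Set.eq_of_subset_of_ncard_le hs
    ((h.ncard_bdry_preCut hY).2.trans (h.ncard_bdry_preCut hX).2.symm).le
    (h.ncard_bdry_preCut hY).1

end IsThinCutSystem

namespace IsCutSystem

theorem cstar_cstar (h : IsCutSystem G 𝒞) (hX : PreCut G 𝒞 X) : cstar G (cstar G X) = X := by
  obtain hX | ⟨C, hC, rfl⟩ := hX
  · exact h.star_star X hX
  · rw [h.star_star C hC]

theorem preCut_cstar (h : IsCutSystem G 𝒞) (hX : PreCut G 𝒞 X) : PreCut G 𝒞 (cstar G X) := by
  obtain hX | ⟨C, hC, rfl⟩ := hX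
  · exact Or.inr ⟨X, hX, rfl⟩
  · rw [h.star_star C hC]
    exact Or.inl hC

theorem mem_of_isCompOf_corner (h : IsCutSystem G 𝒞) (hX : PreCut G 𝒞 X) (hY : PreCut G 𝒞 Y)
    (h₁ : ∃ E ∈ 𝒞, E ⊆ X ∩ Y) (h₂ : ∃ E ∈ 𝒞, E ⊆ cstar G X ∩ cstar G Y)
    (hQ : IsCompOf G Q (X ∩ Y)) (hF : F ∈ 𝒞) (hFQ : F ⊆ Q) : Q ∈ 𝒞 := by
  obtain hX | ⟨C, hC, rfl⟩ := hX <;> obtain hY | ⟨D, hD, rfl⟩ := hY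
  · exact h.a1 X hX Y hY _ _ (Or.inl ⟨rfl, rfl⟩) h₁ h₂ Q (Or.inl hQ) ⟨F, hF, hFQ⟩
  · rw [h.star_star D hD] at h₂
    exact h.a1 X hX D hD _ _ (Or.inr (Or.inr (Or.inl ⟨rfl, rfl⟩))) h₁ h₂ Q (Or.inl hQ)
      ⟨F, hF, hFQ⟩
  · rw [h.star_star C hC] at h₂
    exact h.a1 C hC Y hY _ _ (Or.inr (Or.inr (Or.inr ⟨rfl, rfl⟩))) h₁ h₂ Q (Or.inl hQ)
      ⟨F, hF, hFQ⟩
  · rw [h.star_star D hD, h.star_star C hC] at h₂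
    exact h.a1 C hC D hD _ _ (Or.inr (Or.inl ⟨rfl, rfl⟩)) h₁ h₂ Q (Or.inl hQ) ⟨F, hF, hFQ⟩

theorem exists_subset_cstar (h : IsCutSystem G 𝒞) (hC : C ∈ 𝒞) : ∃ E ∈ 𝒞, E ⊆ cstar G C := by
  obtain ⟨A, B, hAB, hA, hB⟩ := h.a2 C hC C hC
  have hempty : ∀ E ∈ 𝒞, E ⊆ C ∩ cstar G C → False := by
    intro E hE hEC
    obtain ⟨v, hv⟩ := h.nonempty E hE
    exact (mem_cstar.1 (hEC hv).2).1 (hEC hv).1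
  obtain ⟨rfl, rfl⟩ | ⟨rfl, rfl⟩ | ⟨rfl, rfl⟩ | ⟨rfl, rfl⟩ := hAB
  · exact hB.imp fun E hE => ⟨hE.1, hE.2.trans Set.inter_subset_left⟩
  · exact hA.imp fun E hE => ⟨hE.1, hE.2.trans Set.inter_subset_left⟩
  · obtain ⟨E, hE, hEC⟩ := hA
    exact (hempty E hE hEC).elim
  · obtain ⟨E, hE, hEC⟩ := hB
    exact (hempty E hE hEC).elim

theorem exists_subset_preCut (h : IsCutSystem G 𝒞) (hX : PreCut G 𝒞 X) : ∃ E ∈ 𝒞, E ⊆ X := by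
  obtain hX | ⟨C, hC, rfl⟩ := hX
  · exact ⟨X, hX, subset_rfl⟩
  · exact h.exists_subset_cstar hC

theorem exists_isCompOf_corner (h : IsCutSystem G 𝒞) (hX : PreCut G 𝒞 X) (hY : PreCut G 𝒞 Y)
    (h₁ : ∃ E ∈ 𝒞, E ⊆ X ∩ Y) (h₂ : ∃ E ∈ 𝒞, E ⊆ cstar G X ∩ cstar G Y)
    (hF : F ∈ 𝒞) (hFs : F ⊆ X ∩ Y) : ∃ Q ∈ 𝒞, IsCompOf G Q (X ∩ Y) ∧ F ⊆ Q := by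
  obtain ⟨Q, hQ, hFQ⟩ := (h.conn F hF).exists_isCompOf hFs
  exact ⟨Q, h.mem_of_isCompOf_corner hX hY h₁ h₂ hQ hF hFQ, hQ, hFQ⟩

end IsCutSystem

namespace IsThinCutSystem

theorem exists_component (h : IsThinCutSystem G 𝒞 κ) (hX : PreCut G 𝒞 X) (hF : F ∈ 𝒞)
    (hFX : F ⊆ X) : ∃ P ∈ 𝒞, F ⊆ P ∧ P ⊆ X ∧ bdry G P = bdry G X := by
  have hc := h.toIsCutSystem
  have h₁ : ∃ E ∈ 𝒞, E ⊆ X ∩ X := ⟨F, hF, Set.subset_inter hFX hFX⟩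
  have h₂ : ∃ E ∈ 𝒞, E ⊆ cstar G X ∩ cstar G X := by
    rw [Set.inter_self]
    exact hc.exists_subset_preCut (hc.preCut_cstar hX)
  obtain ⟨P, hP, hPX, hFP⟩ := hc.exists_isCompOf_corner hX hX h₁ h₂ hF (Set.subset_inter hFX hFX)
  rw [Set.inter_self] at hPX
  exact ⟨P, hP, hFP, hPX.1, h.bdry_eq_of_subset (Or.inl hP) hX hPX.bdry_subset⟩

/-- A cut nested with two pre-cuts is nested with each component of their corner. -/
theorem nested_component_corner (h : IsThinCutSystem G 𝒞 κ)
    (h₂ : ∃ E ∈ 𝒞, E ⊆ cstar G X ∩ cstar G Y) (hQ : IsCompOf G Q (X ∩ Y)) (hE : E ∈ 𝒞)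
    (hXE : Nested G 𝒞 X E) (hYE : Nested G 𝒞 Y E) : Nested G 𝒞 Q E := by
  have hc := h.toIsCutSystem
  have hQX : Q ⊆ X := hQ.1.trans Set.inter_subset_left
  have hQY : Q ⊆ Y := hQ.1.trans Set.inter_subset_right
  have hdisj : ∀ {A B : Set V}, A ∩ B = ∅ → ∀ v ∈ A, v ∉ B := fun hAB =>
    Set.disjoint_left.1 (Set.disjoint_iff_inter_eq_empty.2 hAB)
  have hin : ∀ {Z : Set V}, (¬ ∃ F ∈ 𝒞, F ⊆ cstar G Z ∩ E) → E ∩ bdry G Z = ∅ → E ⊆ Z :=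
    fun hno hb => ((hc.conn E hE).subset_or_subset_cstar (hdisj hb)).resolve_right
      fun hs => hno ⟨E, hE, Set.subset_inter hs subset_rfl⟩
  have mixed : ∀ {Z W : Set V}, (∃ F ∈ 𝒞, F ⊆ cstar G Z ∩ cstar G W) →
      (¬ ∃ F ∈ 𝒞, F ⊆ cstar G Z ∩ cstar G E) → cstar G Z ∩ bdry G E = ∅ → E ⊆ W → False := by
    rintro Z W ⟨F, hF, hFs⟩ hno hb hEW
    obtain hs | hs := (hc.conn F hF).subset_or_subset_cstar
      fun v hv => hdisj hb v (hFs hv).1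
    · obtain ⟨v, hv⟩ := hc.nonempty F hF
      exact (mem_cstar.1 (hFs hv).2).1 (hEW (hs hv))
    · exact hno ⟨F, hF, Set.subset_inter (hFs.trans Set.inter_subset_left) hs⟩
  rw [nested_iff] at hXE hYE
  obtain ⟨-, hX, -⟩ | ⟨-, hX, -⟩ | ⟨hXno, hX, hX'⟩ | ⟨hXno, hX, hX'⟩ := hXE
  · exact h.nested_of_disjoint_bdry hQ.2.1 fun v hv => hdisj hX v (hQX hv)
  · exact h.nested_of_disjoint_bdry hQ.2.1 fun v hv => hdisj hX v (hQX hv)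
  all_goals obtain ⟨-, hY, -⟩ | ⟨-, hY, -⟩ | ⟨hYno, hY, hY'⟩ | ⟨hYno, hY, hY'⟩ := hYE
  · exact h.nested_of_disjoint_bdry hQ.2.1 fun v hv => hdisj hY v (hQY hv)
  · exact h.nested_of_disjoint_bdry hQ.2.1 fun v hv => hdisj hY v (hQY hv)
  · rw [nested_comm]
    exact h.nested_of_disjoint_bdry (hc.conn E hE) fun v hv hvQ =>
      hQ.notMem_of_mem_bdry hvQ ⟨hin hXno hX' hv, hin hYno hY' hv⟩
  · rw [Set.inter_comm] at h₂
    exact (mixed h₂ hYno hY (hin hXno hX')).elim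
  · exact h.nested_of_disjoint_bdry hQ.2.1 fun v hv => hdisj hY v (hQY hv)
  · exact h.nested_of_disjoint_bdry hQ.2.1 fun v hv => hdisj hY v (hQY hv)
  · exact (mixed h₂ hXno hX (hin hYno hY')).elim
  by_cases hQE : ∀ v ∈ Q, v ∉ bdry G E
  · exact h.nested_of_disjoint_bdry hQ.2.1 hQE
  push Not at hQE
  obtain ⟨q, hqQ, hqE⟩ := hQE
  have key : ∀ F ∈ 𝒞, F ⊆ cstar G E → F ⊆ Q ∧ bdry G E ⊆ Q ∪ bdry G Q := by
    intro F hF hFE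
    obtain ⟨P, hP, hFP, hPE, hPb⟩ :=
      h.exists_component (hc.preCut_cstar (Or.inl hE)) hF hFE
    rw [bdry_cstar (hc.star_star E hE)] at hPb
    have hPX : P ⊆ X :=
      ((hc.conn P hP).subset_or_subset_cstar fun v hv => hdisj hX' v (hPE hv)).resolve_right
        fun hs => hXno ⟨P, hP, Set.subset_inter hs hPE⟩
    have hPY : P ⊆ Y :=
      ((hc.conn P hP).subset_or_subset_cstar fun v hv => hdisj hY' v (hPE hv)).resolve_right
        fun hs => hYno ⟨P, hP, Set.subset_inter hs hPE⟩
    have hPQ : ∀ v ∈ P, v ∉ bdry G Q := fun v hv hvQ =>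
      hQ.notMem_of_mem_bdry hvQ ⟨hPX hv, hPY hv⟩
    rw [← hPb] at hqE ⊢
    obtain ⟨-, p, hp, hpq⟩ := hqE
    have hpQ : p ∈ Q := (mem_union_bdry_of_adj hqQ hpq.symm).resolve_right (hPQ p hp)
    have hPsub := (hc.conn P hP).subset_of_mem hp hpQ hPQ
    exact ⟨hFP.trans hPsub, bdry_subset_of_subset hPsub⟩
  obtain ⟨F, hF, hFE⟩ := hc.exists_subset_cstar hE
  rw [nested_iff]
  refine Or.inr (Or.inr (Or.inr ⟨?_, ?_, ?_⟩))
  · rintro ⟨F', hF', hs⟩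
    obtain ⟨v, hv⟩ := hc.nonempty F' hF'
    exact (mem_cstar.1 (hs hv).1).1 ((key F' hF' (hs.trans Set.inter_subset_right)).1 hv)
  · exact Set.disjoint_iff_inter_eq_empty.1
      (Set.disjoint_left.2 fun v hv hv' => hv ((key F hF hFE).2 hv'))
  · refine Set.disjoint_iff_inter_eq_empty.1 (Set.disjoint_left.2 fun v hv hv' => ?_)
    have hvX := bdry_subset_of_subset hQX hv'
    have hvY := bdry_subset_of_subset hQY hv'
    exact hQ.notMem_of_mem_bdry hv'
      ⟨hvX.resolve_right (hdisj hX' v hv), hvY.resolve_right (hdisj hY' v hv)⟩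

theorem nested_or_nested (h : IsThinCutSystem G 𝒞 κ) (hQ : ConnSet G Q) (hR : ConnSet G R)
    (hQX : Q ⊆ X) (hRX : R ⊆ cstar G X) (hXE : Nested G 𝒞 X E) :
    Nested G 𝒞 Q E ∨ Nested G 𝒞 R E := by
  have hdisj : ∀ {A B : Set V}, A ∩ B = ∅ → ∀ v ∈ A, v ∉ B := fun hAB =>
    Set.disjoint_left.1 (Set.disjoint_iff_inter_eq_empty.2 hAB)
  rw [nested_iff] at hXE
  obtain ⟨-, hX, -⟩ | ⟨-, hX, -⟩ | ⟨-, hX, -⟩ | ⟨-, hX, -⟩ := hXE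
  · exact Or.inl (h.nested_of_disjoint_bdry hQ fun v hv => hdisj hX v (hQX hv))
  · exact Or.inl (h.nested_of_disjoint_bdry hQ fun v hv => hdisj hX v (hQX hv))
  · exact Or.inr (h.nested_of_disjoint_bdry hR fun v hv => hdisj hX v (hRX hv))
  · exact Or.inr (h.nested_of_disjoint_bdry hR fun v hv => hdisj hX v (hRX hv))

theorem nested_of_bdry_eq (h : IsThinCutSystem G 𝒞 κ) (hX : PreCut G 𝒞 X)
    (hb : bdry G X = bdry G Y) : Nested G 𝒞 X Y := by
  have hc := h.toIsCutSystem
  obtain hX | ⟨C, hC, rfl⟩ := hX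
  · exact h.nested_of_disjoint_bdry (hc.conn X hX) fun v hv hv' => (hb ▸ hv').1 hv
  · rw [nested_cstar_left (hc.star_star C hC)]
    rw [bdry_cstar (hc.star_star C hC)] at hb
    exact h.nested_of_disjoint_bdry (hc.conn C hC) fun v hv hv' => (hb ▸ hv').1 hv

theorem exists_mem_bdry_component (h : IsThinCutSystem G 𝒞 κ) (hX : PreCut G 𝒞 X)
    (hY : PreCut G 𝒞 Y) (hn : ¬ Nested G 𝒞 X Y) (h₁ : ∃ E ∈ 𝒞, E ⊆ X ∩ Y)
    (h₂ : ∃ E ∈ 𝒞, E ⊆ cstar G X ∩ cstar G Y) :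
    ∃ W ∈ 𝒞, W ⊆ cstar G Y ∧ bdry G W = bdry G Y ∧ ∃ y ∈ bdry G X, y ∈ W := by
  have hc := h.toIsCutSystem
  have hXX := hc.cstar_cstar hX
  have hYY := hc.cstar_cstar hY
  obtain ⟨F₁, hF₁, hFs₁⟩ := id h₁
  obtain ⟨F₂, hF₂, hFs₂⟩ := id h₂
  obtain ⟨Q₁, hQ₁, hQc₁, -⟩ := hc.exists_isCompOf_corner hX hY h₁ h₂ hF₁ hFs₁
  obtain ⟨Q₂, hQ₂, hQc₂, -⟩ := hc.exists_isCompOf_corner (hc.preCut_cstar hX)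
    (hc.preCut_cstar hY) h₂ (by rwa [hXX, hYY]) hF₂ hFs₂
  obtain ⟨hXf, hXk⟩ := h.ncard_bdry_preCut hX
  obtain ⟨hYf, hYk⟩ := h.ncard_bdry_preCut hY
  let L₁ := (bdry G X ∪ bdry G Y) ∩ ((X ∪ bdry G X) ∩ (Y ∪ bdry G Y))
  let L₂ := (bdry G X ∪ bdry G Y) ∩ ((cstar G X ∪ bdry G X) ∩ (cstar G Y ∪ bdry G Y))
  have hf := hXf.union hYf
  have hL₁f : L₁.Finite := hf.subset Set.inter_subset_left
  have hL₂f : L₂.Finite := hf.subset Set.inter_subset_left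
  have hNQ₁ : bdry G Q₁ ⊆ L₁ := by
    intro v hv
    have hvX := bdry_subset_of_subset (hQc₁.1.trans Set.inter_subset_left) hv
    have hvY := bdry_subset_of_subset (hQc₁.1.trans Set.inter_subset_right) hv
    refine ⟨?_, hvX, hvY⟩
    have := hQc₁.notMem_of_mem_bdry hv
    simp only [Set.mem_inter_iff, Set.mem_union] at *
    tauto
  have hNQ₂ : bdry G Q₂ ⊆ L₂ := by
    intro v hv
    have hvX := bdry_subset_of_subset (hQc₂.1.trans Set.inter_subset_left) hv
    have hvY := bdry_subset_of_subset (hQc₂.1.trans Set.inter_subset_right) hv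
    rw [bdry_cstar hXX] at hvX
    rw [bdry_cstar hYY] at hvY
    refine ⟨?_, hvX, hvY⟩
    have := hQc₂.notMem_of_mem_bdry hv
    simp only [Set.mem_inter_iff, Set.mem_union] at *
    tauto
  have hcard : L₁.ncard + L₂.ncard ≤ κ + κ := by
    rw [← Set.ncard_union_add_ncard_inter L₁ L₂ hL₁f hL₂f]
    have hle₁ : (L₁ ∪ L₂).ncard ≤ (bdry G X ∪ bdry G Y).ncard :=
      Set.ncard_le_ncard (Set.union_subset Set.inter_subset_left Set.inter_subset_left) hf
    have hle₂ : (L₁ ∩ L₂).ncard ≤ (bdry G X ∩ bdry G Y).ncard := by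
      refine Set.ncard_le_ncard ?_ (hXf.subset Set.inter_subset_left)
      rintro v ⟨⟨-, hvX, hvY⟩, -, hvX', hvY'⟩
      simp only [Set.mem_union, mem_cstar] at *
      exact ⟨by tauto, by tauto⟩
    have := Set.ncard_union_add_ncard_inter (bdry G X) (bdry G Y) hXf hYf
    omega
  have hk₁ := Set.ncard_le_ncard hNQ₁ hL₁f
  have hk₂ := Set.ncard_le_ncard hNQ₂ hL₂f
  rw [h.thin _ hQ₁] at hk₁
  rw [h.thin _ hQ₂] at hk₂
  have hNQ₂' : bdry G Q₂ = L₂ :=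
    Set.eq_of_subset_of_ncard_le hNQ₂ (by rw [h.thin _ hQ₂]; omega) hL₂f
  by_cases hd : ∃ y ∈ bdry G X, y ∈ cstar G Y
  · obtain ⟨y, hyX, hyY⟩ := hd
    obtain ⟨W, hW, hQW, hWY, hWb⟩ := h.exists_component (hc.preCut_cstar hY) hQ₂
      (hQc₂.1.trans Set.inter_subset_right)
    rw [bdry_cstar hYY] at hWb
    refine ⟨W, hW, hWY, hWb, y, hyX, ?_⟩
    have hyQ : y ∈ bdry G Q₂ := hNQ₂' ▸ ⟨Or.inl hyX, Or.inr hyX, Or.inl hyY⟩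
    refine (bdry_subset_of_subset hQW hyQ).resolve_right fun hyW => ?_
    exact (mem_cstar.1 hyY).2 (hWb ▸ hyW)
  · exfalso
    push Not at hd
    have hXL : bdry G X ⊆ L₁ := by
      intro v hv
      have := hd v hv
      rw [mem_cstar] at this
      refine ⟨Or.inl hv, Or.inr hv, ?_⟩
      simp only [Set.mem_union]
      tauto
    have hXL' : bdry G X = L₁ := Set.eq_of_subset_of_ncard_le hXL (by omega) hL₁f
    have ha : ∀ v ∈ X, v ∉ bdry G Y := by
      intro v hv hvY
      have : v ∈ bdry G X := hXL' ▸ ⟨Or.inr hvY, Or.inl hv, Or.inr hvY⟩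
      exact this.1 hv
    obtain ⟨R, hR, hRs⟩ : ∃ R ∈ 𝒞, R ⊆ X ∩ cstar G Y := by
      by_contra hno
      refine hn (nested_iff.2 (Or.inr (Or.inl ⟨hno, ?_, ?_⟩)))
      · exact Set.disjoint_iff_inter_eq_empty.1 (Set.disjoint_left.2 ha)
      · exact Set.disjoint_iff_inter_eq_empty.1
          (Set.disjoint_left.2 fun v hv hv' => hd v hv' hv)
    obtain ⟨W, hW, hRW, hWY, hWb⟩ := h.exists_component (hc.preCut_cstar hY) hR
      (hRs.trans Set.inter_subset_right)
    rw [bdry_cstar hYY] at hWb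
    obtain ⟨r, hr⟩ := hc.nonempty R hR
    have hWX : W ⊆ X :=
      (hc.conn W hW).subset_of_mem (hRW hr) (hRs hr).1 fun v hv hv' => hd v hv' (hWY hv)
    have hYX : bdry G Y ⊆ bdry G X := by
      intro v hv
      exact (bdry_subset_of_subset hWX (hWb.symm ▸ hv)).resolve_left fun hvX => ha v hvX hv
    exact hn (h.nested_of_bdry_eq hX (h.bdry_eq_of_subset hY hX hYX).symm)

end IsThinCutSystem

/-- Two cuts have opposite corners containing cuts, up to replacing the cuts by their
complements. -/
theorem IsCutSystem.exists_preCuts (h : IsCutSystem G 𝒞) (hC : C ∈ 𝒞) (hD : D ∈ 𝒞) :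
    ∃ X Y, (X = C ∨ X = cstar G C) ∧ (Y = D ∨ Y = cstar G D) ∧
      (∃ E ∈ 𝒞, E ⊆ X ∩ Y) ∧ ∃ E ∈ 𝒞, E ⊆ cstar G X ∩ cstar G Y := by
  obtain ⟨A, B, hAB, hA, hB⟩ := h.a2 C hC D hD
  obtain ⟨rfl, rfl⟩ | ⟨rfl, rfl⟩ | ⟨rfl, rfl⟩ | ⟨rfl, rfl⟩ := hAB
  · exact ⟨C, D, Or.inl rfl, Or.inl rfl, hA, hB⟩
  · exact ⟨C, D, Or.inl rfl, Or.inl rfl, hB, hA⟩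
  · exact ⟨C, cstar G D, Or.inl rfl, Or.inr rfl, hA, by rwa [h.star_star D hD]⟩
  · exact ⟨C, cstar G D, Or.inl rfl, Or.inr rfl, hB, by rwa [h.star_star D hD]⟩

theorem preCut_of_eq_or_eq (hC : C ∈ 𝒞) (hX : X = C ∨ X = cstar G C) : PreCut G 𝒞 X := by
  obtain rfl | rfl := hX
  · exact Or.inl hC
  · exact Or.inr ⟨C, hC, rfl⟩

namespace IsThinCutSystem

theorem exists_separated_bdry (h : IsThinCutSystem G 𝒞 κ) (hC : C ∈ 𝒞) (hD : D ∈ 𝒞)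
    (hn : ¬ Nested G 𝒞 C D) :
    ∃ x ∈ bdry G C, ∃ y ∈ bdry G C, x ∈ D ∧ bdry G D ∈ tightSeps G x y ∅ κ := by
  have hc := h.toIsCutSystem
  have hDD := hc.star_star D hD
  have hCC := hc.star_star C hC
  obtain ⟨X, Y, hX, hY, h₁, h₂⟩ := hc.exists_preCuts hC hD
  have hXp := preCut_of_eq_or_eq hC hX
  have hYp := preCut_of_eq_or_eq hD hY
  have hXX := hc.cstar_cstar hXp
  have hYY := hc.cstar_cstar hYp
  have hnXY : ¬ Nested G 𝒞 X Y := by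
    obtain rfl | rfl := hX <;> obtain rfl | rfl := hY <;>
      simpa only [nested_cstar_left hCC, nested_cstar_right hDD] using hn
  have hXb : bdry G X = bdry G C := by
    obtain rfl | rfl := hX
    · rfl
    · exact bdry_cstar hCC
  have hYb : bdry G Y = bdry G D := by
    obtain rfl | rfl := hY
    · rfl
    · exact bdry_cstar hDD
  obtain ⟨W, hW, hWY, hWb, y, hyC, hyW⟩ := h.exists_mem_bdry_component hXp hYp hnXY h₁ h₂
  obtain ⟨U, hU, hUY, hUb, x, hxC, hxU⟩ := h.exists_mem_bdry_component (hc.preCut_cstar hXp)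
    (hc.preCut_cstar hYp) (by rwa [nested_cstar_left hXX, nested_cstar_right hYY]) h₂
    (by rwa [hXX, hYY])
  rw [bdry_cstar hXX] at hxC
  rw [bdry_cstar hYY] at hUb
  rw [hYY] at hUY
  rw [hXb] at hxC hyC
  rw [hYb] at hWb hUb
  have key : ∀ {U W : Set V} {x y : V}, W ∈ 𝒞 → W ⊆ cstar G D → bdry G W = bdry G D →
      U ⊆ D → x ∈ U → y ∈ W → x ∈ D ∧ bdry G D ∈ tightSeps G x y ∅ κ := by
    intro U W x y hW hWD hWb hUD hx hy
    refine ⟨hUD hx, hc.finBd D hD, h.thin D hD, Set.disjoint_empty _, D, W, hc.conn D hD,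
      hc.conn W hW, hUD hx, hy, (mem_cstar.1 (hWD hy)).1, Set.disjoint_empty _,
      Set.disjoint_empty _, subset_rfl, Set.subset_union_left, hWb.ge⟩
  obtain rfl | rfl := hY
  · exact ⟨x, hxC, y, hyC, key hW hWY hWb hUY hxU hyW⟩
  · rw [hDD] at hWY
    exact ⟨y, hyC, x, hxC, key hU hUY hUb hWY hyW hxU⟩

theorem finite_not_nested (h : IsThinCutSystem G 𝒞 κ) (hC : C ∈ 𝒞) :
    {D ∈ 𝒞 | ¬ Nested G 𝒞 C D}.Finite := by
  have hc := h.toIsCutSystem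
  have hfin : ∀ x y, {D ∈ 𝒞 | x ∈ D ∧ bdry G D ∈ tightSeps G x y ∅ κ}.Finite := by
    intro x y
    refine Set.Finite.of_finite_image (f := bdry G)
      ((finite_tightSeps G x y κ ∅).subset ?_) ?_
    · rintro _ ⟨D, hD, rfl⟩
      exact hD.2.2
    · rintro D ⟨hD, hxD, -⟩ E ⟨hE, hxE, -⟩ hDE
      refine Set.Subset.antisymm ?_ ?_
      · exact (hc.conn D hD).subset_of_mem hxD hxE fun v hv hv' => (hDE.symm ▸ hv').1 hv
      · exact (hc.conn E hE).subset_of_mem hxE hxD fun v hv hv' => (hDE ▸ hv').1 hv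
  have hb := hc.finBd C hC
  refine (hb.biUnion fun x _ => hb.biUnion fun y _ => hfin x y).subset ?_
  rintro D ⟨hD, hn⟩
  obtain ⟨x, hx, y, hy, hxy⟩ := h.exists_separated_bdry hC hD hn
  simp only [Set.mem_iUnion]
  exact ⟨x, hx, y, hy, hD, hxy⟩

/-- Submodularity of `mu`, strict for cuts that are not nested. -/
theorem mu_add_mu_le (h : IsThinCutSystem G 𝒞 κ) (hC : C ∈ 𝒞) (hD : D ∈ 𝒞)
    (hX : X = C ∨ X = cstar G C) (hY : Y = D ∨ Y = cstar G D)
    (hQ : Q ∈ 𝒞) (hR : R ∈ 𝒞) (hQc : IsCompOf G Q (X ∩ Y))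
    (hRc : IsCompOf G R (cstar G X ∩ cstar G Y)) :
    mu G 𝒞 Q + mu G 𝒞 R ≤ mu G 𝒞 C + mu G 𝒞 D ∧
      (¬ Nested G 𝒞 C D → mu G 𝒞 Q + mu G 𝒞 R < mu G 𝒞 C + mu G 𝒞 D) := by
  have hc := h.toIsCutSystem
  have hXX := hc.cstar_cstar (preCut_of_eq_or_eq hC hX)
  have hYY := hc.cstar_cstar (preCut_of_eq_or_eq hD hY)
  have hXn : ∀ E, Nested G 𝒞 C E ↔ Nested G 𝒞 X E := by
    intro E
    obtain rfl | rfl := hX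
    · rfl
    · rw [nested_cstar_left (hc.star_star C hC)]
  have hYn : ∀ E, Nested G 𝒞 D E ↔ Nested G 𝒞 Y E := by
    intro E
    obtain rfl | rfl := hY
    · rfl
    · rw [nested_cstar_left (hc.star_star D hD)]
  have hQX := hQc.1.trans Set.inter_subset_left
  have hQY := hQc.1.trans Set.inter_subset_right
  have hRX := hRc.1.trans Set.inter_subset_left
  have hRY := hRc.1.trans Set.inter_subset_right
  let N : Set V → Set (Set V) := fun A => {E ∈ 𝒞 | ¬ Nested G 𝒞 A E}
  have hNf : ∀ {A}, A ∈ 𝒞 → (N A).Finite := fun hA => h.finite_not_nested hA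
  have hunion : N Q ∪ N R ⊆ N C ∪ N D := by
    rintro E (⟨hE, hn⟩ | ⟨hE, hn⟩)
    · by_contra hcon
      simp only [N, Set.mem_union, Set.mem_ofPred_eq, hE, true_and, not_or, not_not] at hcon
      exact hn (h.nested_component_corner ⟨R, hR, hRc.1⟩ hQc hE ((hXn E).1 hcon.1)
        ((hYn E).1 hcon.2))
    · by_contra hcon
      simp only [N, Set.mem_union, Set.mem_ofPred_eq, hE, true_and, not_or, not_not] at hcon
      refine hn (h.nested_component_corner ⟨Q, hQ, ?_⟩ hRc hE ?_ ?_)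
      · rw [hXX, hYY]
        exact hQc.1
      · exact (nested_cstar_left hXX).2 ((hXn E).1 hcon.1)
      · exact (nested_cstar_left hYY).2 ((hYn E).1 hcon.2)
  have hinter : N Q ∩ N R ⊆ N C ∩ N D := by
    rintro E ⟨⟨hE, hnQ⟩, -, hnR⟩
    refine ⟨⟨hE, fun hn => ?_⟩, hE, fun hn => ?_⟩
    · exact (h.nested_or_nested (hc.conn Q hQ) (hc.conn R hR) hQX hRX ((hXn E).1 hn)).elim hnQ hnR
    · exact (h.nested_or_nested (hc.conn Q hQ) (hc.conn R hR) hQY hRY ((hYn E).1 hn)).elim hnQ hnR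
  have hCDf := (hNf hC).union (hNf hD)
  have e₁ : (N Q ∪ N R).ncard + (N Q ∩ N R).ncard = mu G 𝒞 Q + mu G 𝒞 R :=
    Set.ncard_union_add_ncard_inter _ _ (hNf hQ) (hNf hR)
  have e₂ : (N C ∪ N D).ncard + (N C ∩ N D).ncard = mu G 𝒞 C + mu G 𝒞 D :=
    Set.ncard_union_add_ncard_inter _ _ (hNf hC) (hNf hD)
  have l₁ := Set.ncard_le_ncard hunion hCDf
  have l₂ := Set.ncard_le_ncard hinter ((hNf hC).subset Set.inter_subset_left)
  refine ⟨by omega, fun hn => ?_⟩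
  have hlt : (N Q ∪ N R).ncard < (N C ∪ N D).ncard := by
    refine Set.ncard_lt_ncard ((Set.ssubset_iff_of_subset hunion).2 ⟨C, ?_, ?_⟩) hCDf
    · exact Or.inr ⟨hC, fun hn' => hn (nested_comm.1 hn')⟩
    · have hXb : bdry G X = bdry G C := by
        obtain rfl | rfl := hX
        · rfl
        · exact bdry_cstar (hc.star_star C hC)
      rintro (⟨-, hn'⟩ | ⟨-, hn'⟩)
      · refine hn' (h.nested_of_disjoint_bdry (hc.conn Q hQ) fun v hv hv' => ?_)
        exact (hXb.symm ▸ hv').1 (hQX hv)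
      · refine hn' (h.nested_of_disjoint_bdry (hc.conn R hR) fun v hv hv' => ?_)
        exact (mem_cstar.1 (hRX hv)).2 (hXb.symm ▸ hv')
  omega

end IsThinCutSystem

/-- The optimally nested cuts: those for which `mu` is minimal. -/
def optCuts (G : SimpleGraph V) (𝒞 : Set (Set V)) : Set (Set V) :=
  {C | C ∈ 𝒞 ∧ ∀ C' ∈ 𝒞, mu G 𝒞 C ≤ mu G 𝒞 C'}

namespace IsThinCutSystem

theorem mem_optCuts_of_isCompOf_corner (h : IsThinCutSystem G 𝒞 κ) (hC : C ∈ optCuts G 𝒞)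
    (hD : D ∈ optCuts G 𝒞) (hX : X = C ∨ X = cstar G C) (hY : Y = D ∨ Y = cstar G D)
    (h₁ : ∃ E ∈ 𝒞, E ⊆ X ∩ Y) (h₂ : ∃ E ∈ 𝒞, E ⊆ cstar G X ∩ cstar G Y)
    (hQ : IsCompOf G Q (X ∩ Y)) (hF : ∃ E ∈ 𝒞, E ⊆ Q) :
    Q ∈ optCuts G 𝒞 ∧ Nested G 𝒞 C D := by
  have hc := h.toIsCutSystem
  have hXp := preCut_of_eq_or_eq hC.1 hX
  have hYp := preCut_of_eq_or_eq hD.1 hY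
  obtain ⟨E, hE, hEQ⟩ := hF
  have hQm := hc.mem_of_isCompOf_corner hXp hYp h₁ h₂ hQ hE hEQ
  obtain ⟨F, hF, hFs⟩ := id h₂
  obtain ⟨R, hR, hRc, -⟩ := hc.exists_isCompOf_corner (hc.preCut_cstar hXp)
    (hc.preCut_cstar hYp) h₂ (by rwa [hc.cstar_cstar hXp, hc.cstar_cstar hYp]) hF hFs
  obtain ⟨hle, hlt⟩ := h.mu_add_mu_le hC.1 hD.1 hX hY hQm hR hQ hRc
  have hCQ := hC.2 Q hQm
  have hDR := hD.2 R hR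
  refine ⟨⟨hQm, fun C' hC' => ?_⟩, ?_⟩
  · have := hC.2 C' hC'
    omega
  · by_contra hn
    have := hlt hn
    omega

theorem exists_mem_optCuts_corner (h : IsThinCutSystem G 𝒞 κ) (hC : C ∈ optCuts G 𝒞)
    (hD : D ∈ optCuts G 𝒞) (hX : X = C ∨ X = cstar G C) (hY : Y = D ∨ Y = cstar G D)
    (h₁ : ∃ E ∈ 𝒞, E ⊆ X ∩ Y) (h₂ : ∃ E ∈ 𝒞, E ⊆ cstar G X ∩ cstar G Y) :
    (∃ E ∈ optCuts G 𝒞, E ⊆ X ∩ Y) ∧ Nested G 𝒞 C D := by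
  obtain ⟨F, hF, hFs⟩ := id h₁
  obtain ⟨Q, hQc, hFQ⟩ := (h.toIsCutSystem.conn F hF).exists_isCompOf hFs
  obtain ⟨hQ, hn⟩ := h.mem_optCuts_of_isCompOf_corner hC hD hX hY h₁ h₂ hQc ⟨F, hF, hFQ⟩
  exact ⟨⟨Q, hQ, hQc.1⟩, hn⟩

theorem nested_of_mem_optCuts (h : IsThinCutSystem G 𝒞 κ) (hC : C ∈ optCuts G 𝒞)
    (hD : D ∈ optCuts G 𝒞) : Nested G 𝒞 C D := by
  obtain ⟨X, Y, hX, hY, h₁, h₂⟩ := h.toIsCutSystem.exists_preCuts hC.1 hD.1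
  exact (h.exists_mem_optCuts_corner hC hD hX hY h₁ h₂).2

theorem isCutSystem_optCuts (h : IsThinCutSystem G 𝒞 κ) : IsCutSystem G (optCuts G 𝒞) := by
  have hc := h.toIsCutSystem
  refine ⟨fun C hC => hc.nonempty C hC.1, fun C hC => hc.conn C hC.1,
    fun C hC => hc.finBd C hC.1, fun C hC => hc.star_star C hC.1, ?_, ?_⟩
  · intro C hC D hD A B hAB hA hB Q hQ hEQ
    have weaken : ∀ {Z : Set V}, (∃ E ∈ optCuts G 𝒞, E ⊆ Z) → ∃ E ∈ 𝒞, E ⊆ Z :=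
      fun ⟨E, hE, hs⟩ => ⟨E, hE.1, hs⟩
    replace hA := weaken hA
    replace hB := weaken hB
    replace hEQ := weaken hEQ
    have hCC := hc.star_star C hC.1
    have hDD := hc.star_star D hD.1
    have key : ∀ X Y, (X = C ∨ X = cstar G C) → (Y = D ∨ Y = cstar G D) →
        (∃ E ∈ 𝒞, E ⊆ X ∩ Y) → (∃ E ∈ 𝒞, E ⊆ cstar G X ∩ cstar G Y) →
        IsCompOf G Q (X ∩ Y) → Q ∈ optCuts G 𝒞 := fun X Y hX hY h₁ h₂ hQ =>
      (h.mem_optCuts_of_isCompOf_corner hC hD hX hY h₁ h₂ hQ hEQ).1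
    have k₁ := key C D (Or.inl rfl) (Or.inl rfl)
    have k₂ := key C (cstar G D) (Or.inl rfl) (Or.inr rfl)
    have k₃ := key (cstar G C) D (Or.inr rfl) (Or.inl rfl)
    have k₄ := key (cstar G C) (cstar G D) (Or.inr rfl) (Or.inr rfl)
    rw [hDD] at k₂
    rw [hCC] at k₃
    rw [hCC, hDD] at k₄
    obtain ⟨rfl, rfl⟩ | ⟨rfl, rfl⟩ | ⟨rfl, rfl⟩ | ⟨rfl, rfl⟩ := hAB
    · exact hQ.elim (k₁ hA hB) (k₄ hB hA)
    · exact hQ.elim (k₄ hA hB) (k₁ hB hA)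
    · exact hQ.elim (k₂ hA hB) (k₃ hB hA)
    · exact hQ.elim (k₃ hA hB) (k₂ hB hA)
  · intro C hC D hD
    obtain ⟨X, Y, hX, hY, h₁, h₂⟩ := hc.exists_preCuts hC.1 hD.1
    have hCC := hc.star_star C hC.1
    have hDD := hc.star_star D hD.1
    have hXX := hc.cstar_cstar (preCut_of_eq_or_eq hC.1 hX)
    have hYY := hc.cstar_cstar (preCut_of_eq_or_eq hD.1 hY)
    have hX' : cstar G X = C ∨ cstar G X = cstar G C := by
      obtain rfl | rfl := hX
      · exact Or.inr rfl
      · exact Or.inl hCC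
    have hY' : cstar G Y = D ∨ cstar G Y = cstar G D := by
      obtain rfl | rfl := hY
      · exact Or.inr rfl
      · exact Or.inl hDD
    refine ⟨X ∩ Y, cstar G X ∩ cstar G Y, ?_,
      (h.exists_mem_optCuts_corner hC hD hX hY h₁ h₂).1,
      (h.exists_mem_optCuts_corner hC hD hX' hY' h₂ (by rwa [hXX, hYY])).1⟩
    unfold OppCorners
    obtain rfl | rfl := hX <;> obtain rfl | rfl := hY
    · exact Or.inl ⟨rfl, rfl⟩
    · exact Or.inr (Or.inr (Or.inl ⟨rfl, by rw [hDD]⟩))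
    · exact Or.inr (Or.inr (Or.inr ⟨rfl, by rw [hCC]⟩))
    · exact Or.inr (Or.inl ⟨rfl, by rw [hCC, hDD]⟩)

end IsThinCutSystem

end ThinCuts

theorem stmt18 (G : SimpleGraph V) (hG : G.Connected) (𝒞 : Set (Set V)) (κ : ℕ)
    (h : IsThinCutSystem G 𝒞 κ) :
    (∀ C D : Set V, C ∈ 𝒞 → D ∈ 𝒞 →
      (∀ C' ∈ 𝒞, mu G 𝒞 C ≤ mu G 𝒞 C') →
      (∀ C' ∈ 𝒞, mu G 𝒞 D ≤ mu G 𝒞 C') →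
      C ≠ D → Nested G 𝒞 C D) ∧
    IsCutSystem G {C | C ∈ 𝒞 ∧ ∀ C' ∈ 𝒞, mu G 𝒞 C ≤ mu G 𝒞 C'} := by
  exact ⟨fun _ _ hC hD hCm hDm _ => h.nested_of_mem_optCuts ⟨hC, hCm⟩ ⟨hD, hDm⟩,
    h.isCutSystem_optCuts⟩
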